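/- arXiv:2308.09450 — 3 statements merged into one kernel-verified Lean document; each statement's English description precedes it below -/
import Mathlib

section
/- Let T > 0 and let γ, v : [0,T) × ℝ → ℝ be continuously differentiable functions satisfying ∂_t γ(t,x) + v(t,x)·∂_x γ(t,x) = γ(t,x)²/2 − (∂_x v)(t,x)·γ(t,x) for all (t,x). Let y : [0,T) × ℝ → ℝ satisfy ∂_t y(t,x) = v(t, y(t,x)) and y(0,x) = x, let q(t,x) := ∂_x y(t,x) exist with q(0,x) = 1, and assume for each x that t ↦ q(t,x) is differentiable with ∂_t q(t,x) = (∂_x v)(t, y(t,x))·q(t,x). Then for all (t,x) ∈ [0,T) × ℝ: γ(t, y(t,x))·q(t,x) = γ(0,x)·exp(∫₀ᵗ (1/2)·γ(s, y(s,x)) ds). -/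
open Real Set intervalIntegral

/-- The integrating factor formula for the scalar linear equation `f' = g f`, with right
derivatives. -/
theorem eq_mul_exp_integral_of_hasDerivWithinAt_Ici {f g : ℝ → ℝ} {a b : ℝ} (hab : a ≤ b)
    (hf : ContinuousOn f (Set.Icc a b)) (hg : ContinuousOn g (Set.Icc a b))
    (hfg : ∀ s ∈ Set.Ico a b, HasDerivWithinAt f (g s * f s) (Set.Ici s) s) :
    f b = f a * Real.exp (∫ s in a..b, g s) := by
  have hint : IntervalIntegrable g MeasureTheory.volume a b :=
    ContinuousOn.intervalIntegrable_of_Icc hab hg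
  have hprim : ContinuousOn (fun u => ∫ s in a..u, g s) (Set.Icc a b) := by
    have h := intervalIntegral.continuousOn_primitive_interval' hint Set.left_mem_uIcc
    rwa [Set.uIcc_of_le hab] at h
  have hderiv : ∀ s ∈ Set.Ico a b,
      HasDerivWithinAt (fun u => ∫ r in a..u, g r) (g s) (Set.Ici s) s := by
    intro s hs
    have hsub : Set.Ioo s b ⊆ Set.Icc a b := fun r hr => ⟨hs.1.trans hr.1.le, hr.2.le⟩
    have hmem : Set.Ioo s b ∈ nhdsWithin s (Set.Ioi s) := Ioo_mem_nhdsGT hs.2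
    refine intervalIntegral.integral_hasDerivWithinAt_right (t := Set.Ioi s)
      (hint.mono_set ?_) ⟨Set.Ioo s b, hmem, ?_⟩ ?_
    · rw [Set.uIcc_of_le hs.1, Set.uIcc_of_le hab]
      exact Set.Icc_subset_Icc_right hs.2.le
    · exact (hg.mono hsub).aestronglyMeasurable measurableSet_Ioo
    · exact ((hg s ⟨hs.1, hs.2.le⟩).mono hsub).mono_of_mem_nhdsWithin hmem
  have hconst := constant_of_has_deriv_right_zero
    (f := fun u => f u * Real.exp (-∫ s in a..u, g s)) (hf.mul hprim.neg.rexp)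
    (fun s hs => ((hfg s hs).mul (hderiv s hs).neg.exp).congr_deriv (by ring))
    b (Set.right_mem_Icc.2 hab)
  simp only [intervalIntegral.integral_same, neg_zero, Real.exp_zero, mul_one] at hconst
  rw [← hconst, mul_assoc, ← Real.exp_add, neg_add_cancel, Real.exp_zero, mul_one]

/-- The chain rule along a curve `s ↦ (s, c s)` for a function of two variables that is
differentiable on a strip, in terms of its partial derivatives. -/
theorem hasDerivWithinAt_along_curve {F : ℝ → ℝ → ℝ} {c : ℝ → ℝ} {I : Set ℝ} {t Ft Fx c' : ℝ}
    (hI : UniqueDiffWithinAt ℝ I t) (ht : t ∈ I)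
    (hF : DifferentiableWithinAt ℝ (fun p : ℝ × ℝ => F p.1 p.2) (I ×ˢ Set.univ) (t, c t))
    (hFt : HasDerivAt (fun s => F s (c t)) Ft t) (hFx : HasDerivAt (F t) Fx (c t))
    (hc : HasDerivWithinAt c c' I t) :
    HasDerivWithinAt (fun s => F s (c s)) (Ft + c' * Fx) I t := by
  obtain ⟨L, hL⟩ := hF
  have hLt : L (1, 0) = Ft := hI.eq_deriv _
    (hL.comp_hasDerivWithinAt (f := fun s => (s, c t)) t
      ((hasDerivWithinAt_id t I).prodMk (hasDerivWithinAt_const t I (c t)))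
      (fun s hs => ⟨hs, Set.mem_univ _⟩)) hFt.hasDerivWithinAt
  have hLx : L (0, 1) = Fx := uniqueDiffWithinAt_univ.eq_deriv _
    (hL.comp_hasDerivWithinAt (f := fun z => (t, z)) (c t)
      ((hasDerivWithinAt_const (c t) Set.univ t).prodMk (hasDerivWithinAt_id (c t) Set.univ))
      (fun z _ => ⟨ht, Set.mem_univ _⟩)) hFx.hasDerivWithinAt
  refine (hL.comp_hasDerivWithinAt (f := fun s => (s, c s)) t
    ((hasDerivWithinAt_id t I).prodMk hc) (fun s hs => ⟨hs, Set.mem_univ _⟩)).congr_deriv ?_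
  have hsplit : ((1, c') : ℝ × ℝ) = (1, 0) + c' • (0, 1) := by simp
  rw [hsplit, map_add, map_smul, hLt, hLx, smul_eq_mul]

/-- If `γ` solves the transport form of the MOCH equation `γ_t + v γ_x = γ²/2 − v_x γ`, `y` is
the flow of `v`, and `q = ∂_x y` (with `q(0,x)=1`) satisfies the linearized flow equation
`q_t = v_x(t,y)·q`, then `γ(t, y(t,x))·q(t,x) = γ(0,x)·exp(∫₀ᵗ (1/2)·γ(s, y(s,x)) ds)`. -/
theorem moch_density_along_flow_formula
    (T : ℝ) (hT : 0 < T) (γ v γt γx vx y q : ℝ → ℝ → ℝ)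
    -- `γ`, `v` are `C¹` with the indicated partial derivatives
    (hγC1 : ContDiffOn ℝ 1 (fun p : ℝ × ℝ => γ p.1 p.2) (Set.Ico 0 T ×ˢ Set.univ))
    (hvC1 : ContDiffOn ℝ 1 (fun p : ℝ × ℝ => v p.1 p.2) (Set.Ico 0 T ×ˢ Set.univ))
    (hγt : ∀ t ∈ Set.Ico 0 T, ∀ x : ℝ, HasDerivAt (fun s => γ s x) (γt t x) t)
    (hγx : ∀ t ∈ Set.Ico 0 T, ∀ x : ℝ, HasDerivAt (fun z => γ t z) (γx t x) x)
    (hvx : ∀ t ∈ Set.Ico 0 T, ∀ x : ℝ, HasDerivAt (fun z => v t z) (vx t x) x)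
    -- transport form of the MOCH equation
    (htransport : ∀ t ∈ Set.Ico 0 T, ∀ x : ℝ,
      γt t x + v t x * γx t x = γ t x ^ 2 / 2 - vx t x * γ t x)
    -- `y` is the flow of `v`
    (hyt : ∀ x : ℝ, ∀ t ∈ Set.Ico 0 T, HasDerivAt (fun s => y s x) (v t (y t x)) t)
    (hy0 : ∀ x : ℝ, y 0 x = x)
    -- `q = ∂_x y` with `q(0,x) = 1`
    (hq : ∀ t ∈ Set.Ico 0 T, ∀ x : ℝ, HasDerivAt (fun z => y t z) (q t x) x)
    (hq0 : ∀ x : ℝ, q 0 x = 1)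
    -- linearized flow equation `q_t = v_x(t,y)·q`
    (hqt : ∀ x : ℝ, ∀ t ∈ Set.Ico 0 T,
      HasDerivAt (fun s => q s x) (vx t (y t x) * q t x) t) :
    ∀ t ∈ Set.Ico 0 T, ∀ x : ℝ,
      γ t (y t x) * q t x
        = γ 0 x * Real.exp (∫ s in (0 : ℝ)..t, (1 / 2) * γ s (y s x)) := by
  intro t ht x
  have hγy : ∀ s ∈ Set.Ico 0 T, HasDerivWithinAt (fun r => γ r (y r x))
      (γt s (y s x) + v s (y s x) * γx s (y s x)) (Set.Ico 0 T) s := fun s hs =>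
    hasDerivWithinAt_along_curve (uniqueDiffOn_Ico 0 T s hs) hs
      (hγC1.differentiableOn one_ne_zero _ ⟨hs, Set.mem_univ _⟩) (hγt s hs _) (hγx s hs _)
      (hyt x s hs).hasDerivWithinAt
  have hsub : Set.Icc 0 t ⊆ Set.Ico 0 T := Set.Icc_subset_Ico_right ht.2
  have hcont : ContinuousOn (fun r => γ r (y r x)) (Set.Icc 0 t) := fun s hs =>
    (hγy s (hsub hs)).continuousWithinAt.mono hsub
  have hcontq : ContinuousOn (fun r => q r x) (Set.Icc 0 t) := fun s hs =>
    (hqt x s (hsub hs)).continuousAt.continuousWithinAt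
  have hmain := eq_mul_exp_integral_of_hasDerivWithinAt_Ici ht.1 (hcont.mul hcontq)
    (hcont.const_mul (1 / 2)) fun s hs => by
      have hsT : s ∈ Set.Ico 0 T := hsub ⟨hs.1, hs.2.le⟩
      refine (((hγy s hsT).mul (hqt x s hsT).hasDerivWithinAt).mono_of_mem_nhdsWithin
        (Filter.mem_of_superset (Ico_mem_nhdsGE hsT.2)
          (Set.Ico_subset_Ico_left hsT.1))).congr_deriv ?_
      rw [htransport s hsT (y s x)]
      simp only [Pi.mul_apply]
      ring
  simpa [hy0, hq0] using hmain
end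

section
/- Let λ ∈ ℝ with λ ≠ 0 and T > 0. Let γ, v : [0,T) × ℝ → ℝ with γ continuously differentiable in (t,x) and v twice continuously differentiable in x, satisfying for all (t,x): ∂_t γ = λ·∂_x(∂_x v − γ − (1/λ)·v·γ) and ∂_x² v = ∂_x γ + γ²/(2λ). Let y : [0,T) × ℝ → ℝ satisfy ∂_t y(t,x) = v(t, y(t,x)) and y(0,x) = x, assume that for each t ∈ [0,T) the map y(t,·) : ℝ → ℝ is a continuous strictly increasing bijection of ℝ, that q(t,x) := ∂_x y(t,x) exists with q(0,x) = 1, q(t,x) > 0, and that for each x the map t ↦ q(t,x) is differentiable with ∂_t q = (∂_x v)(t,y)·q. If the initial datum γ(0,·) has support contained in a compact set K ⊆ ℝ, then for every t ∈ [0,T) the support of γ(t,·) is contained in the compact set y(t, K); in particular γ(t,·) has compact support for every t ∈ [0,T). -/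
open Real Set Function

/-- The chain rule along a curve `s ↦ (s, c s)` for a function that is differentiable on a time
slab `[0, T) × ℝ`, expressed through its partial derivatives. -/
lemma hasDerivWithinAt_along_curve_s6 {T t ft fx c' : ℝ} {f : ℝ → ℝ → ℝ} {c : ℝ → ℝ}
    (ht : t ∈ Ico 0 T)
    (hf : DifferentiableWithinAt ℝ (fun p : ℝ × ℝ => f p.1 p.2) (Ico 0 T ×ˢ univ) (t, c t))
    (hft : HasDerivAt (fun s => f s (c t)) ft t) (hfx : HasDerivAt (fun z => f t z) fx (c t))
    (hc : HasDerivAt c c' t) :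
    HasDerivWithinAt (fun s => f s (c s)) (ft + c' * fx) (Ico 0 T) t := by
  obtain ⟨L, hL⟩ := hf
  have along_curve : HasDerivWithinAt (fun s => f s (c s)) (L (1, c')) (Ico 0 T) t :=
    HasFDerivWithinAt.comp_hasDerivWithinAt (f := fun s => (s, c s)) t hL
      ((hasDerivAt_id t).prodMk hc).hasDerivWithinAt (fun s hs => ⟨hs, mem_univ _⟩)
  have along_time : HasDerivWithinAt (fun s => f s (c t)) (L (1, 0)) (Ico 0 T) t :=
    HasFDerivWithinAt.comp_hasDerivWithinAt (f := fun s => (s, c t)) t hL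
      ((hasDerivAt_id t).prodMk (hasDerivAt_const t (c t))).hasDerivWithinAt
      (fun s hs => ⟨hs, mem_univ _⟩)
  have along_space : HasDerivAt (fun z => f t z) (L (0, 1)) (c t) := by
    rw [← hasDerivWithinAt_univ]
    exact HasFDerivWithinAt.comp_hasDerivWithinAt (f := fun z => (t, z)) (c t) hL
      ((hasDerivAt_const (c t) t).prodMk (hasDerivAt_id (c t))).hasDerivWithinAt
      (fun z _ => ⟨ht, mem_univ _⟩)
  have time_eq : L (1, 0) = ft :=
    (uniqueDiffOn_Ico 0 T t ht).eq_deriv _ along_time hft.hasDerivWithinAt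
  have space_eq : L (0, 1) = fx := along_space.unique hfx
  have split : L (1, c') = ft + c' * fx := by
    rw [← time_eq, ← space_eq, ← smul_eq_mul, ← map_smul, ← map_add]
    simp
  rwa [split] at along_curve

/-- A solution of the scalar linear equation `h' = a h` on `[0, T)` with continuous coefficient
and `h 0 = 0` vanishes identically. -/
lemma eq_zero_of_linear_ode {T : ℝ} {a h : ℝ → ℝ} (ha : ContinuousOn a (Ico 0 T))
    (hh : ∀ t ∈ Ico 0 T, HasDerivWithinAt h (a t * h t) (Ico 0 T) t) (h0 : h 0 = 0) :
    ∀ t ∈ Ico 0 T, h t = 0 := by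
  intro t ht
  have hsub : Icc 0 t ⊆ Ico 0 T := fun s hs => ⟨hs.1, hs.2.trans_lt ht.2⟩
  obtain ⟨C, hC⟩ := isCompact_Icc.exists_bound_of_continuousOn (ha.mono hsub)
  refine eq_zero_of_abs_deriv_le_mul_abs_self_of_eq_zero_right (K := C) (f' := fun s => a s * h s)
    (fun s hs => ((hh s (hsub hs)).continuousWithinAt).mono hsub) (fun s hs => ?_) h0
    (fun s hs => ?_) t ⟨ht.1, le_rfl⟩
  · have hs' := hsub (Ico_subset_Icc_self hs)
    refine (hh s hs').mono_of_mem_nhdsWithin ?_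
    exact Filter.mem_of_superset (Ico_mem_nhdsGE hs'.2) (Ico_subset_Ico_left hs'.1)
  · rw [norm_mul]
    exact mul_le_mul_of_nonneg_right (hC s (Ico_subset_Icc_self hs)) (norm_nonneg _)

/-- Persistence of compact support for the modified Camassa–Holm equation: if `(γ, v)` solves
the MOCH system `γ_t = λ(v_x − γ − (1/λ)vγ)_x`, `v_xx = γ_x + γ²/(2λ)`, `y` is the flow of `v`
(an increasing homeomorphism of `ℝ` for each `t`), `q = ∂_x y > 0` solves the linearized flow
equation, and `γ(0,·)` is supported in a compact set `K`, then for every `t` the support of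
`γ(t,·)` is contained in the compact set `y(t,K)`; in particular `γ(t,·)` has compact support. -/
theorem moch_persistence_compact_support
    (lam : ℝ) (hlam : lam ≠ 0) (T : ℝ) (hT : 0 < T)
    (γ v γt γx vx vxx y q : ℝ → ℝ → ℝ)
    -- regularity: `γ` is `C¹` in `(t,x)`
    (hγC1 : ContDiffOn ℝ 1 (fun p : ℝ × ℝ => γ p.1 p.2) (Set.Ico 0 T ×ˢ Set.univ))
    (hγt : ∀ t ∈ Set.Ico 0 T, ∀ x : ℝ, HasDerivAt (fun s => γ s x) (γt t x) t)
    (hγx : ∀ t ∈ Set.Ico 0 T, ∀ x : ℝ, HasDerivAt (fun z => γ t z) (γx t x) x)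
    -- `v` is twice continuously differentiable in `x`
    (hvC2 : ∀ t ∈ Set.Ico 0 T, ContDiff ℝ 2 (fun z => v t z))
    (hvx : ∀ t ∈ Set.Ico 0 T, ∀ x : ℝ, HasDerivAt (fun z => v t z) (vx t x) x)
    (hvxx : ∀ t ∈ Set.Ico 0 T, ∀ x : ℝ, HasDerivAt (fun z => vx t z) (vxx t x) x)
    -- the MOCH system: `γ_t = λ·∂_x(v_x − γ − (1/λ)·v·γ)` and `v_xx = γ_x + γ²/(2λ)`
    (heq1 : ∀ t ∈ Set.Ico 0 T, ∀ x : ℝ, ∃ w : ℝ,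
      HasDerivAt (fun z => vx t z - γ t z - (1 / lam) * (v t z * γ t z)) w x ∧
      γt t x = lam * w)
    (heq2 : ∀ t ∈ Set.Ico 0 T, ∀ x : ℝ, vxx t x = γx t x + γ t x ^ 2 / (2 * lam))
    -- `y` is the flow of `v`
    (hyt : ∀ x : ℝ, ∀ t ∈ Set.Ico 0 T, HasDerivAt (fun s => y s x) (v t (y t x)) t)
    (hy0 : ∀ x : ℝ, y 0 x = x)
    -- for each `t`, `y(t,·)` is a continuous strictly increasing bijection of `ℝ`
    (hycont : ∀ t ∈ Set.Ico 0 T, Continuous (fun z => y t z))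
    (hymono : ∀ t ∈ Set.Ico 0 T, StrictMono (fun z => y t z))
    (hybij : ∀ t ∈ Set.Ico 0 T, Function.Bijective (fun z => y t z))
    -- `q = ∂_x y` with `q(0,x)=1`, `q > 0`, and `q_t = v_x(t,y)·q`
    (hq : ∀ t ∈ Set.Ico 0 T, ∀ x : ℝ, HasDerivAt (fun z => y t z) (q t x) x)
    (hq0 : ∀ x : ℝ, q 0 x = 1)
    (hqpos : ∀ t ∈ Set.Ico 0 T, ∀ x : ℝ, 0 < q t x)
    (hqt : ∀ x : ℝ, ∀ t ∈ Set.Ico 0 T,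
      HasDerivAt (fun s => q s x) (vx t (y t x) * q t x) t)
    -- the initial datum has support contained in a compact set `K`
    (K : Set ℝ) (hK : IsCompact K) (hsupp0 : tsupport (fun x => γ 0 x) ⊆ K) :
    ∀ t ∈ Set.Ico 0 T,
      tsupport (fun x => γ t x) ⊆ (fun z => y t z) '' K ∧
      HasCompactSupport (fun x => γ t x) := by
  have pde : ∀ t ∈ Ico 0 T, ∀ x,
      γt t x = γ t x ^ 2 / 2 - vx t x * γ t x - v t x * γx t x := by
    intro t ht x
    obtain ⟨w, hw, hγw⟩ := heq1 t ht x
    have hw' := ((hvxx t ht x).sub (hγx t ht x)).sub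
      (((hvx t ht x).mul (hγx t ht x)).const_mul (1 / lam))
    rw [hγw, hw.unique hw', heq2 t ht x]
    field_simp
    ring
  have along_flow : ∀ x, ∀ t ∈ Ico 0 T, HasDerivWithinAt (fun s => γ s (y s x))
      (γt t (y t x) + v t (y t x) * γx t (y t x)) (Ico 0 T) t := fun x t ht =>
    hasDerivWithinAt_along_curve_s6 (c := fun s => y s x) ht
      (hγC1.differentiableOn one_ne_zero _ ⟨ht, mem_univ _⟩)
      (hγt t ht _) (hγx t ht _) (hyt x t ht)
  have vanishing : ∀ x, γ 0 x = 0 → ∀ t ∈ Ico 0 T, γ t (y t x) = 0 := by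
    intro x hx t ht
    have hzero : γ t (y t x) * q t x = 0 := by
      refine eq_zero_of_linear_ode (a := fun s => γ s (y s x) / 2)
        (h := fun s => γ s (y s x) * q s x)
        (fun s hs => (along_flow x s hs).continuousWithinAt.div_const 2) (fun s hs => ?_) ?_ t ht
      · refine ((along_flow x s hs).mul (hqt x s hs).hasDerivWithinAt).congr_deriv ?_
        rw [pde s hs]
        ring
      · simp [hy0, hx]
    exact (mul_eq_zero.mp hzero).resolve_right (hqpos t ht x).ne'
  intro t ht
  have image_compact : IsCompact ((fun z => y t z) '' K) := hK.image (hycont t ht)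
  have support_subset : support (fun x => γ t x) ⊆ (fun z => y t z) '' K := by
    intro z hz
    obtain ⟨x, rfl⟩ := (hybij t ht).surjective z
    exact ⟨x, hsupp0 (subset_tsupport _ fun hx => hz (vanishing x hx t ht)), rfl⟩
  have tsupport_subset := closure_minimal support_subset image_compact.isClosed
  exact ⟨tsupport_subset, image_compact.of_isClosed_subset (isClosed_tsupport _) tsupport_subset⟩
end

section
/- Let f : ℝ → ℝ be continuous, bounded, and Lebesgue integrable. Define u : ℝ → ℝ by u(x) = −(1/2)·∫_ℝ e^{−|x−y|}·f(y) dy, and set n(x) = u'(x) + u(x). Then n is differentiable on ℝ and for every x ∈ ℝ, n'(x) − n(x) = f(x); that is, (∂_x + 1) applied to the solution of (∂_x² − 1)u = f produces a solution of (∂_x − 1)n = f. -/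
open Real MeasureTheory

/-- The derivative of `x ↦ ∫_{-∞}^x g` is `g` when `g` is continuous and integrable near `-∞`. -/
theorem hasDerivAt_integral_Iic {g : ℝ → ℝ} (hg : Continuous g)
    (hi : ∀ a, IntegrableOn g (Set.Iic a)) (x : ℝ) :
    HasDerivAt (fun t => ∫ y in Set.Iic t, g y) (g x) x := by
  have h : (fun t => ∫ y in Set.Iic t, g y) =
      fun t => (∫ y in Set.Iic 0, g y) + ∫ y in (0 : ℝ)..t, g y := by
    ext t
    linarith [intervalIntegral.integral_Iic_sub_Iic (hi 0) (hi t)]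
  rw [h]
  exact (hg.integral_hasStrictDerivAt 0 x).hasDerivAt.const_add _

/-- The derivative of `x ↦ ∫_x^∞ g` is `-g` when `g` is continuous and integrable near `∞`. -/
theorem hasDerivAt_integral_Ioi {g : ℝ → ℝ} (hg : Continuous g)
    (hi : ∀ a, IntegrableOn g (Set.Ioi a)) (x : ℝ) :
    HasDerivAt (fun t => ∫ y in Set.Ioi t, g y) (-g x) x := by
  have h : (fun t => ∫ y in Set.Ioi t, g y) =
      fun t => (∫ y in Set.Ioi 0, g y) - ∫ y in (0 : ℝ)..t, g y := by
    ext t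
    linarith [intervalIntegral.integral_interval_add_Ioi (hi 0) (hi t)]
  rw [h]
  exact (hg.integral_hasStrictDerivAt 0 x).hasDerivAt.const_sub _

theorem integrableOn_Iic_exp_mul {f : ℝ → ℝ} (hf : Integrable f) (a : ℝ) :
    IntegrableOn (fun y => exp y * f y) (Set.Iic a) := by
  refine Integrable.bdd_mul (c := exp a) hf.integrableOn
    continuous_exp.aestronglyMeasurable ?_
  filter_upwards [ae_restrict_mem measurableSet_Iic] with y hy
  simpa using hy

theorem integrableOn_Ioi_exp_neg_mul {f : ℝ → ℝ} (hf : Integrable f) (a : ℝ) :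
    IntegrableOn (fun y => exp (-y) * f y) (Set.Ioi a) := by
  refine Integrable.bdd_mul (c := exp (-a)) hf.integrableOn
    (by fun_prop : Continuous fun y : ℝ => exp (-y)).aestronglyMeasurable ?_
  filter_upwards [ae_restrict_mem measurableSet_Ioi] with y hy
  simpa using (Set.mem_Ioi.1 hy).le

/-- Convolution with `e^{-|x|}` split at the diagonal. -/
theorem integral_exp_neg_abs_sub_mul {f : ℝ → ℝ} (hf : Integrable f) (x : ℝ) :
    ∫ y : ℝ, exp (-|x - y|) * f y =
      exp (-x) * (∫ y in Set.Iic x, exp y * f y) +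
        exp x * ∫ y in Set.Ioi x, exp (-y) * f y := by
  have hint : Integrable fun y : ℝ => exp (-|x - y|) * f y := by
    refine hf.bdd_mul (c := 1)
      (by fun_prop : Continuous fun y : ℝ => exp (-|x - y|)).aestronglyMeasurable ?_
    exact .of_forall fun y => by simp
  rw [← intervalIntegral.integral_Iic_add_Ioi (b := x) hint.integrableOn hint.integrableOn,
    ← integral_const_mul, ← integral_const_mul]
  congr 1
  · refine setIntegral_congr_fun measurableSet_Iic fun y hy => ?_
    have hxy : y ≤ x := hy
    simp only [abs_of_nonneg (sub_nonneg.2 hxy), ← mul_assoc, ← exp_add]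
    ring_nf
  · refine setIntegral_congr_fun measurableSet_Ioi fun y hy => ?_
    have hxy : x < y := hy
    simp only [abs_of_neg (sub_neg.2 hxy), ← mul_assoc, ← exp_add]
    ring_nf

/-- With `G = ∂_x² - 1` and `G⁻¹` realized by convolution with `-(1/2)e^{-|x|}`, the operator
identity `(∂_x + 1) G⁻¹ = (∂_x - 1)^{-1}` holds: if `u(x) = -(1/2)∫ e^{-|x-y|} f(y) dy` and
`n = u' + u`, then `n` is differentiable and `n' - n = f`. -/
theorem dx_plus_one_Ginv
    (f : ℝ → ℝ) (hf_cont : Continuous f) (hf_bdd : ∃ C : ℝ, ∀ x : ℝ, |f x| ≤ C)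
    (hf_int : Integrable f)
    (u : ℝ → ℝ) (hu : ∀ x : ℝ, u x = -(1 / 2) * ∫ y : ℝ, Real.exp (-|x - y|) * f y)
    (n : ℝ → ℝ) (hn : ∀ x : ℝ, n x = deriv u x + u x) :
    ∀ x : ℝ, DifferentiableAt ℝ n x ∧ deriv n x - n x = f x := by
  have hR := hasDerivAt_integral_Ioi (g := fun y => exp (-y) * f y) (by fun_prop)
    (integrableOn_Ioi_exp_neg_mul hf_int)
  have hL := hasDerivAt_integral_Iic (g := fun y => exp y * f y) (by fun_prop)
    (integrableOn_Iic_exp_mul hf_int)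
  have hcancel (x : ℝ) : exp x * exp (-x) = 1 := by rw [← exp_add]; simp
  have hn_eq : n = fun x => -(exp x * ∫ y in Set.Ioi x, exp (-y) * f y) := by
    ext x
    have hu_eq : u = fun t => -(1 / 2) * (exp (-t) * (∫ y in Set.Iic t, exp y * f y) +
        exp t * ∫ y in Set.Ioi t, exp (-y) * f y) := by
      ext t
      rw [hu, integral_exp_neg_abs_sub_mul hf_int]
    have hd := ((((hasDerivAt_neg x).exp.mul (hL x)).add
      ((hasDerivAt_exp x).mul (hR x))).const_mul (-(1 / 2) : ℝ)).deriv
    rw [hn, hu_eq]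
    refine (congrArg (· + _) hd).trans ?_
    ring
  intro x
  have hd : HasDerivAt n (-(exp x * (∫ y in Set.Ioi x, exp (-y) * f y) +
      exp x * -(exp (-x) * f x))) x := by
    rw [hn_eq]
    exact ((hasDerivAt_exp x).mul (hR x)).neg
  refine ⟨hd.differentiableAt, ?_⟩
  rw [hd.deriv, hn_eq]
  linear_combination f x * hcancel x
end
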